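/- Let A, B, C be multiplicative characters on F_q with A ≠ ε, B ≠ ε and B ≠ C, and let x ∈ F_q with x ≠ 1. Then ₂F₁*(A, B; C | x) = Ā(1-x) · ₂F₁*(A, B̄C; C | -x/(1-x)). -/

import Mathlib

/-- Multiplicative characters of a finite field with values in `ℂ` form a finite type. -/
noncomputable instance mulCharFintypeC (F : Type*) [Field F] [Fintype F] :
    Fintype (MulChar F ℂ) :=
  Fintype.ofFinite _

/-- The canonical additive character `θ(α) = ζ^{tr(α)}` of a finite field `F` of
characteristic `p`, where `ζ` is a fixed primitive `p`-th root of unity in `ℂ`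
and `tr` is the trace map to `ZMod p = F_p`. -/
noncomputable def addCharTheta (p : ℕ) (F : Type*) [Field F] [Fintype F]
    [Algebra (ZMod p) F] (zeta : ℂ) (a : F) : ℂ :=
  zeta ^ (Algebra.trace (ZMod p) F a).val

/-- The Gauss sum `g(χ) = ∑_{x ∈ F} χ(x) θ(x)`. -/
noncomputable def gaussS (p : ℕ) (F : Type*) [Field F] [Fintype F]
    [Algebra (ZMod p) F] (zeta : ℂ) (χ : MulChar F ℂ) : ℂ :=
  ∑ x : F, χ x * addCharTheta p F zeta x

/-- McCarthy's finite field hypergeometric function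
`₂F₁*(A₀, A₁; B₁ | x) = (1/(q-1)) ∑_χ [g(A₀χ)g(A₁χ)g((B₁χ)⁻¹)g(χ⁻¹)/(g(A₀)g(A₁)g(B₁⁻¹))] χ(x)`. -/
noncomputable def mcCarthy2F1 (p : ℕ) (F : Type*) [Field F] [Fintype F]
    [Algebra (ZMod p) F] (zeta : ℂ) (A₀ A₁ B₁ : MulChar F ℂ) (x : F) : ℂ :=
  (1 / ((Fintype.card F : ℂ) - 1)) * ∑ χ : MulChar F ℂ,
    gaussS p F zeta (A₀ * χ) * gaussS p F zeta (A₁ * χ) * gaussS p F zeta (B₁ * χ)⁻¹ *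
      gaussS p F zeta χ⁻¹ /
        (gaussS p F zeta A₀ * gaussS p F zeta A₁ * gaussS p F zeta B₁⁻¹) * χ x

/-- The finite field Appell function `F₄*(A; B; C, C'; x, y)`. -/
noncomputable def appellF4star (p : ℕ) (F : Type*) [Field F] [Fintype F]
    [Algebra (ZMod p) F] (zeta : ℂ) (A B C C' : MulChar F ℂ) (x y : F) : ℂ :=
  (1 / ((Fintype.card F : ℂ) - 1) ^ 2) * ∑ ψ : MulChar F ℂ, ∑ χ : MulChar F ℂ,
    gaussS p F zeta (A * χ * ψ) * gaussS p F zeta (B * χ * ψ) * gaussS p F zeta (C * ψ)⁻¹ *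
      gaussS p F zeta (C' * χ)⁻¹ * gaussS p F zeta ψ⁻¹ * gaussS p F zeta χ⁻¹ /
        (gaussS p F zeta A * gaussS p F zeta B * gaussS p F zeta C⁻¹ *
          gaussS p F zeta C'⁻¹) *
      (ψ x * χ y)

/-- The finite field Appell function `F₁*(A; B, B'; C; x, y)`. -/
noncomputable def appellF1star (p : ℕ) (F : Type*) [Field F] [Fintype F]
    [Algebra (ZMod p) F] (zeta : ℂ) (A B B' C : MulChar F ℂ) (x y : F) : ℂ :=
  (1 / ((Fintype.card F : ℂ) - 1) ^ 2) * ∑ ψ : MulChar F ℂ, ∑ χ : MulChar F ℂ,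
    gaussS p F zeta (A * χ * ψ) * gaussS p F zeta (B * ψ) * gaussS p F zeta (B' * χ) *
      gaussS p F zeta (C * χ * ψ)⁻¹ * gaussS p F zeta ψ⁻¹ * gaussS p F zeta χ⁻¹ /
        (gaussS p F zeta A * gaussS p F zeta B * gaussS p F zeta B' *
          gaussS p F zeta C⁻¹) *
      (ψ x * χ y)

/-- The Jacobi sum `J(A,B) = ∑_{x ∈ F} A(x) B(1-x)`. -/
noncomputable def jacobiS (F : Type*) [Field F] [Fintype F] (A B : MulChar F ℂ) : ℂ :=
  ∑ x : F, A x * B (1 - x)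

/-- Greene's binomial coefficient `(A choose B) = (B(-1)/q) J(A, B⁻¹)`. -/
noncomputable def binomChar (F : Type*) [Field F] [Fintype F] (A B : MulChar F ℂ) : ℂ :=
  (B (-1) / (Fintype.card F : ℂ)) * jacobiS F A B⁻¹

open MulChar in
/-- Orthogonality of the multiplicative characters of a finite field. -/
theorem sum_mulChar_apply {F : Type*} [Field F] [Fintype F] [DecidableEq F] (a : F) :
    ∑ χ : MulChar F ℂ, χ a = if a = 1 then (Fintype.card F : ℂ) - 1 else 0 := by
  split_ifs with h
  · subst h
    have hcard : Fintype.card (MulChar F ℂ) = Fintype.card F - 1 := by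
      rw [← Nat.card_eq_fintype_card, card_eq_card_units_of_hasEnoughRootsOfUnity F ℂ,
        Nat.card_eq_fintype_card, Fintype.card_units]
    simp [hcard, Nat.cast_sub Fintype.card_pos]
  · obtain ⟨η, hη⟩ := exists_apply_ne_one_of_hasEnoughRootsOfUnity F ℂ h
    refine eq_zero_of_mul_eq_self_left hη ?_
    rw [Finset.mul_sum]
    exact Fintype.sum_bijective (η * ·) (Group.mulLeft_bijective η) _ _
      fun χ ↦ (mul_apply η χ a).symm

theorem addCharTheta_eq_addChar (p : ℕ) [Fact p.Prime] (F : Type*) [Field F] [Fintype F]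
    [Algebra (ZMod p) F] {zeta : ℂ} (hzeta : IsPrimitiveRoot zeta p) :
    ∃ ψ : AddChar F ℂ, ψ.IsPrimitive ∧ ∀ χ, gaussS p F zeta χ = gaussSum χ ψ := by
  have : FiniteDimensional (ZMod p) F := Module.Finite.of_finite
  let φ := AddChar.zmodChar p hzeta.pow_eq_one
  have hφ : φ.IsPrimitive := AddChar.zmodChar_primitive_of_primitive_root p hzeta
  refine ⟨φ.compAddMonoidHom (Algebra.trace (ZMod p) F).toAddMonoidHom,
    AddChar.IsPrimitive.of_ne_one ?_, fun χ ↦ rfl⟩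
  obtain ⟨a, ha⟩ := Algebra.trace_surjective (ZMod p) F 1
  refine AddChar.ne_one_iff.2 ⟨a, fun h ↦ one_ne_zero (α := ZMod p) ?_⟩
  rw [← ha]
  exact (hφ.zmod_char_eq_one_iff p _).1 h

theorem gaussSum_mul_gaussSum_inv {F : Type*} [Field F] [Fintype F] {ψ : AddChar F ℂ}
    (hψ : ψ.IsPrimitive) {χ : MulChar F ℂ} (hχ : χ ≠ 1) :
    gaussSum χ ψ * gaussSum χ⁻¹ ψ = χ (-1) * Fintype.card F := by
  rw [← mul_gaussSum_inv_eq_gaussSum χ⁻¹ ψ, ← gaussSum_mul_gaussSum_eq_card hχ hψ,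
    MulChar.inv_apply' χ (-1), inv_neg_one, mul_left_comm]

theorem gaussSum_complex_ne_zero {F : Type*} [Field F] [Fintype F] {ψ : AddChar F ℂ}
    (hψ : ψ.IsPrimitive) (χ : MulChar F ℂ) : gaussSum χ ψ ≠ 0 := by
  by_cases hχ : χ = 1
  · have h1 : ψ ≠ 1 := by
      have := hψ one_ne_zero
      rwa [AddChar.mulShift_one] at this
    rw [hχ, gaussSum_one_left h1]
    exact neg_ne_zero.2 one_ne_zero
  · exact gaussSum_ne_zero_of_nontrivial (Nat.cast_ne_zero.2 Fintype.card_ne_zero) hχ hψ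

/-- The finite field analogue of the Euler-type integral
`∫ t ^ b * (1 - t) ^ (a - c) * (1 - (1 - x) * t) ^ (-a) dt/t` for `₂F₁(a, b; c | x)`. -/
noncomputable def eulerCharSum {F : Type*} [Field F] [Fintype F] (A B C : MulChar F ℂ)
    (x : F) : ℂ :=
  ∑ t : F, B t * (A * C⁻¹) (1 - t) * A⁻¹ (1 - (1 - x) * t)

theorem sum_jacobiSum_mul_jacobiSum {F : Type*} [Field F] [Fintype F] (A B C : MulChar F ℂ)
    {x : F} (hx : x ≠ 0) :
    ∑ χ : MulChar F ℂ, jacobiSum (B * χ) (C * χ)⁻¹ * jacobiSum (A * χ) χ⁻¹ * χ x =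
      ((Fintype.card F : ℂ) - 1) * eulerCharSum A B C x := by
  classical
  have hterm (χ : MulChar F ℂ) :
      jacobiSum (B * χ) (C * χ)⁻¹ * jacobiSum (A * χ) χ⁻¹ * χ x =
      ∑ t, ∑ s, B t * C⁻¹ (1 - t) * A s * χ (t * (1 - t)⁻¹ * s * (1 - s)⁻¹ * x) := by
    rw [jacobiSum, jacobiSum, Finset.sum_mul_sum, Finset.sum_mul]
    simp only [Finset.sum_mul]
    refine Finset.sum_congr rfl fun t _ ↦ Finset.sum_congr rfl fun s _ ↦ ?_
    simp only [mul_inv, MulChar.mul_apply, map_mul, MulChar.inv_apply' χ]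
    ring
  simp only [hterm]
  rw [Finset.sum_comm, eulerCharSum, Finset.mul_sum]
  refine Finset.sum_congr rfl fun t _ ↦ ?_
  rw [Finset.sum_comm]
  simp only [← Finset.mul_sum, sum_mulChar_apply]
  by_cases ht0 : t = 0
  · simp [ht0, MulChar.map_zero]
  by_cases ht1 : t = 1
  · simp [ht1, MulChar.map_zero]
  have ht1' : 1 - t ≠ 0 := sub_ne_zero.2 (Ne.symm ht1)
  have hiff (s : F) : t * (1 - t)⁻¹ * s * (1 - s)⁻¹ * x = 1 ↔ s * (1 - (1 - x) * t) = 1 - t := by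
    by_cases hs : s = 1
    · subst hs
      simp only [sub_self, inv_zero, mul_zero, zero_mul, zero_ne_one, false_iff, one_mul]
      intro h
      exact mul_ne_zero hx ht0 (by linear_combination h)
    · have hs' : 1 - s ≠ 0 := sub_ne_zero.2 (Ne.symm hs)
      field_simp
      constructor <;> intro h <;> linear_combination h
  simp only [hiff]
  by_cases hD : 1 - (1 - x) * t = 0
  · simp [hD, ht1'.symm, MulChar.map_zero]
  · simp only [← eq_div_iff hD, mul_ite, mul_zero, Finset.sum_ite_eq', Finset.mem_univ, if_true,
      MulChar.mul_apply, div_eq_mul_inv, map_mul, MulChar.inv_apply' A]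
    ring

theorem mcCarthy2F1_eq_eulerCharSum {p : ℕ} {F : Type*} [Field F] [Fintype F]
    [Algebra (ZMod p) F] {zeta : ℂ} {ψ : AddChar F ℂ} (hψ : ψ.IsPrimitive)
    (hg : ∀ χ, gaussS p F zeta χ = gaussSum χ ψ) {A B C : MulChar F ℂ} (hA : A ≠ 1) (hBC : B ≠ C)
    {x : F} (hx : x ≠ 0) :
    mcCarthy2F1 p F zeta A B C x =
      gaussSum (B * C⁻¹) ψ / (gaussSum B ψ * gaussSum C⁻¹ ψ) * eulerCharSum A B C x := by
  have hq : (Fintype.card F : ℂ) - 1 ≠ 0 :=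
    sub_ne_zero.2 (mod_cast Fintype.one_lt_card.ne')
  have hterm (χ : MulChar F ℂ) :
      gaussSum (A * χ) ψ * gaussSum (B * χ) ψ * gaussSum (C * χ)⁻¹ ψ * gaussSum χ⁻¹ ψ /
        (gaussSum A ψ * gaussSum B ψ * gaussSum C⁻¹ ψ) * χ x =
      gaussSum (B * C⁻¹) ψ / (gaussSum B ψ * gaussSum C⁻¹ ψ) *
        (jacobiSum (B * χ) (C * χ)⁻¹ * jacobiSum (A * χ) χ⁻¹ * χ x) := by
    have hAχ : A * χ * χ⁻¹ = A := mul_inv_cancel_right A χ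
    have hBCχ : B * χ * (C * χ)⁻¹ = B * C⁻¹ := by
      rw [mul_inv_rev, mul_assoc, mul_inv_cancel_left]
    have h1 := jacobiSum_mul_nontrivial (hAχ.trans_ne hA) ψ
    have h2 := jacobiSum_mul_nontrivial
      (hBCχ.trans_ne fun h ↦ hBC (mul_inv_eq_one.1 h)) ψ
    rw [hAχ] at h1
    rw [hBCχ] at h2
    have := gaussSum_complex_ne_zero hψ A
    have := gaussSum_complex_ne_zero hψ B
    have := gaussSum_complex_ne_zero hψ C⁻¹
    field_simp
    linear_combination (-χ x * gaussSum A ψ * jacobiSum (A * χ) χ⁻¹) * h2 -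
      (χ x * gaussSum (B * χ) ψ * gaussSum (C * χ)⁻¹ ψ) * h1
  simp only [mcCarthy2F1, hg, hterm]
  rw [← Finset.mul_sum, sum_jacobiSum_mul_jacobiSum A B C hx]
  field_simp

theorem eulerCharSum_pfaff {F : Type*} [Field F] [Fintype F] (A B C : MulChar F ℂ) {x : F}
    (hx : x ≠ 1) :
    A⁻¹ (1 - x) * eulerCharSum A (B⁻¹ * C) C (-x / (1 - x)) = C (-1) * eulerCharSum A B C x := by
  have hx' : 1 - x ≠ 0 := sub_ne_zero.2 hx.symm
  simp only [eulerCharSum, Finset.mul_sum]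
  refine Fintype.sum_bijective _ inv_involutive.bijective _ _ fun t ↦ ?_
  by_cases ht : t = 0
  · simp [ht, MulChar.map_zero]
  have e1 : 1 - t⁻¹ = -1 * (1 - t) * t⁻¹ := by field_simp; ring
  have e2 : 1 - (1 - x) * t⁻¹ = -1 * (1 - x) * (1 - (1 - -x / (1 - x)) * t) * t⁻¹ := by
    field_simp; ring
  have hA1 : A (-1) * A⁻¹ (-1) = 1 := by
    rw [← MulChar.mul_apply, mul_inv_cancel, MulChar.one_apply isUnit_one.neg]
  have hC1 : C (-1) * C⁻¹ (-1) = 1 := by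
    rw [← MulChar.mul_apply, mul_inv_cancel, MulChar.one_apply isUnit_one.neg]
  have hAt : A t⁻¹ * A⁻¹ t⁻¹ = 1 := by
    rw [← MulChar.mul_apply, mul_inv_cancel, MulChar.one_apply (inv_ne_zero ht).isUnit]
  have hB : B⁻¹ t = B t⁻¹ := MulChar.inv_apply' B t
  have hC : C⁻¹ t⁻¹ = C t := by rw [MulChar.inv_apply', inv_inv]
  rw [e1, e2]
  simp only [map_mul, MulChar.mul_apply, hB, hC]
  generalize A⁻¹ (1 - (1 - -x / (1 - x)) * t) = u
  linear_combination (-(A⁻¹ (1 - x) * B t⁻¹ * C t * A (1 - t) * C⁻¹ (1 - t) * u)) *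
    (A (-1) * A⁻¹ (-1) * (C (-1) * C⁻¹ (-1)) * hAt + A (-1) * A⁻¹ (-1) * hC1 + hA1)

theorem stmt8    (p : ℕ) [Fact p.Prime] (hp : p ≠ 2) (F : Type*) [Field F] [Fintype F]
    [Algebra (ZMod p) F] (zeta : ℂ) (hzeta : IsPrimitiveRoot zeta p)
    (A B C : MulChar F ℂ) (hA : A ≠ 1) (hB : B ≠ 1) (hBC : B ≠ C)
    (x : F) (hx : x ≠ 1) :
    mcCarthy2F1 p F zeta A B C x =
    A⁻¹ (1 - x) * mcCarthy2F1 p F zeta A (B⁻¹ * C) C (-x / (1 - x)) := by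
  by_cases hx0 : x = 0
  · simp [hx0, mcCarthy2F1, MulChar.map_zero]
  have hx' : 1 - x ≠ 0 := sub_ne_zero.2 hx.symm
  obtain ⟨ψ, hψ, hg⟩ := addCharTheta_eq_addChar p F hzeta
  have hBC' : B⁻¹ * C ≠ C := fun h ↦ hB (inv_eq_one.1 (mul_eq_right.1 h))
  rw [mcCarthy2F1_eq_eulerCharSum hψ hg hA hBC hx0,
    mcCarthy2F1_eq_eulerCharSum hψ hg hA hBC' (div_ne_zero (neg_ne_zero.2 hx0) hx'),
    mul_left_comm, eulerCharSum_pfaff A B C hx, ← mul_assoc, mul_inv_cancel_right]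
  congr 1
  have hB1 := gaussSum_mul_gaussSum_inv hψ hB
  have hB2 := gaussSum_mul_gaussSum_inv hψ (χ := B * C⁻¹) fun h ↦ hBC (mul_inv_eq_one.1 h)
  have hinv : (B * C⁻¹)⁻¹ = B⁻¹ * C := by rw [mul_inv, inv_inv]
  have hC1 : C⁻¹ (-1) = C (-1) := by rw [MulChar.inv_apply', inv_neg_one]
  rw [hinv, MulChar.mul_apply, hC1] at hB2
  have := gaussSum_complex_ne_zero hψ B
  have := gaussSum_complex_ne_zero hψ (B⁻¹ * C)
  have := gaussSum_complex_ne_zero hψ C⁻¹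
  field_simp
  linear_combination hB2 - C (-1) * hB1
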